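/- For every integer d ≥ 1 and every real ε with 0 < ε < 1, there exists a constant C (depending only on d and ε) such that the following holds: for every integer k ≥ 2, every finite set S of n ≥ 2 points in ℝ^d, and every partition of S into k subsets C_1, …, C_k, there exists a subgraph G = (S, E) of the complete k-partite geometric graph K_{C_1…C_k} with at most C·n·log₂ n edges such that G is a (3+ε)-spanner of K_{C_1…C_k}, i.e., δ_E(p,q) ≤ (3+ε)·δ_K(p,q) for all p, q ∈ S. -/

import Mathlib

open scoped ENNReal

/-- The length of a walk, given as the list of its vertices: the sum of the
Euclidean distances between consecutive vertices. -/
noncomputable def walkLen {P : Type*} [PseudoEMetricSpace P] (xs : List P) : ℝ≥0∞ :=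
  (List.zipWith edist xs xs.tail).sum

/-- `xs` is a walk from `p` to `q` in the graph with edge set `E`:
a nonempty finite sequence starting at `p`, ending at `q`, each consecutive
unordered pair being an edge of `E`. -/
def IsWalk {P : Type*} (E : Set (Sym2 P)) (p q : P) (xs : List P) : Prop :=
  xs.head? = some p ∧ xs.getLast? = some q ∧ xs.Chain' (fun a b => s(a, b) ∈ E)

/-- Graph distance: the infimum of lengths of walks from `p` to `q`
(`∞` if no walk exists). -/
noncomputable def gdist {P : Type*} [PseudoEMetricSpace P] (E : Set (Sym2 P)) (p q : P) :
    ℝ≥0∞ :=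
  ⨅ (xs : List P) (_ : IsWalk E p q xs), walkLen xs

/-- The edge set of the complete `k`-partite geometric graph whose color
classes are `C 0, …, C (k-1)`: all unordered pairs of points lying in two
different classes. -/
def kpartiteEdges {P : Type*} {k : ℕ} (C : Fin k → Set P) : Set (Sym2 P) :=
  {e | ∃ p q : P, e = s(p, q) ∧ ∃ i j : Fin k, i ≠ j ∧ p ∈ C i ∧ q ∈ C j}

theorem IsWalk.induction {P : Type*} {E : Set (Sym2 P)} {q : P}
    {motive : P → List P → Prop} (single : motive q [q])
    (cons : ∀ p x xs, s(p, x) ∈ E → motive x (x :: xs) → motive p (p :: x :: xs)) :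
    ∀ (xs : List P) (p : P), IsWalk E p q xs → motive p xs
  | [], p, h => by simp [IsWalk] at h
  | [x], p, h => by
    obtain ⟨h1, h2, -⟩ := h
    obtain rfl : x = p := by simpa using h1
    obtain rfl : x = q := by simpa using h2
    exact single
  | x :: y :: xs, p, h => by
    obtain ⟨h1, h2, h3⟩ := h
    obtain rfl : x = p := by simpa using h1
    obtain ⟨h4, h5⟩ := List.isChain_cons_cons.1 h3
    exact cons _ _ _ h4 (IsWalk.induction single cons (y :: xs) y
      ⟨rfl, by simpa [List.getLast?_cons_cons] using h2, h5⟩)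

section GraphDistance

variable {P : Type*} [PseudoEMetricSpace P] {E : Set (Sym2 P)} {p q r : P}

theorem gdist_self_eq_zero (E : Set (Sym2 P)) (p : P) : gdist E p p = 0 := by
  refine le_antisymm (iInf₂_le_of_le [p] ?_ ?_) zero_le
  · exact ⟨rfl, rfl, List.isChain_singleton p⟩
  · simp [walkLen]

theorem gdist_le_edist_add (h : s(p, q) ∈ E) : gdist E p r ≤ edist p q + gdist E q r := by
  unfold gdist
  simp only [ENNReal.add_iInf]
  refine le_iInf₂ fun xs hxs => ?_
  cases xs with
  | nil => simp [IsWalk] at hxs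
  | cons x xs =>
    obtain ⟨h1, h2, h3⟩ := hxs
    obtain rfl : x = q := by simpa using h1
    refine iInf₂_le_of_le (p :: x :: xs) ⟨rfl, ?_, ?_⟩ ?_
    · simpa [List.getLast?_cons_cons] using h2
    · exact List.isChain_cons_cons.2 ⟨h, h3⟩
    · simp [walkLen]

theorem gdist_le_edist (h : s(p, q) ∈ E) : gdist E p q ≤ edist p q := by
  simpa [gdist_self_eq_zero] using gdist_le_edist_add (r := q) h

theorem gdist_triangle (E : Set (Sym2 P)) (p q r : P) :
    gdist E p r ≤ gdist E p q + gdist E q r := by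
  conv_rhs => rw [gdist]
  simp only [ENNReal.iInf_add]
  refine le_iInf₂ fun xs hxs => ?_
  refine IsWalk.induction (motive := fun p xs => gdist E p r ≤ walkLen xs + gdist E q r)
    ?_ ?_ xs p hxs
  · simp [walkLen]
  · intro p x xs h ih
    calc gdist E p r ≤ edist p x + gdist E x r := gdist_le_edist_add h
      _ ≤ edist p x + (walkLen (x :: xs) + gdist E q r) := by gcongr
      _ = walkLen (p :: x :: xs) + gdist E q r := by simp [walkLen, add_assoc]

theorem gdist_le_gdist_symm (E : Set (Sym2 P)) (p q : P) : gdist E p q ≤ gdist E q p := by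
  conv_rhs => rw [gdist]
  refine le_iInf₂ fun xs hxs => ?_
  refine IsWalk.induction (motive := fun q xs => gdist E p q ≤ walkLen xs) ?_ ?_ xs q hxs
  · simp [gdist_self_eq_zero]
  · intro q x xs h ih
    calc gdist E p q ≤ gdist E p x + gdist E x q := gdist_triangle E p x q
      _ ≤ walkLen (x :: xs) + edist x q :=
        add_le_add ih (gdist_le_edist (by rwa [Sym2.eq_swap]))
      _ = walkLen (q :: x :: xs) := by simp [walkLen, add_comm, edist_comm]

/-- It suffices to bound the stretch of a subgraph on the edges of the ambient graph. -/
theorem gdist_le_mul_gdist {F : Set (Sym2 P)} {t : ℝ≥0∞} (ht0 : t ≠ 0) (ht : t ≠ ⊤)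
    (h : ∀ p q, s(p, q) ∈ F → gdist E p q ≤ t * edist p q) (p q : P) :
    gdist E p q ≤ t * gdist F p q := by
  conv_rhs => rw [gdist]
  simp only [ENNReal.mul_iInf_of_ne ht0 ht]
  refine le_iInf₂ fun xs hxs => ?_
  refine IsWalk.induction (motive := fun p xs => gdist E p q ≤ t * walkLen xs) ?_ ?_ xs p hxs
  · simp [gdist_self_eq_zero]
  · intro p x xs hpx ih
    calc gdist E p q ≤ gdist E p x + gdist E x q := gdist_triangle E p x q
      _ ≤ t * edist p x + t * walkLen (x :: xs) := add_le_add (h p x hpx) ih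
      _ = t * walkLen (p :: x :: xs) := by simp [walkLen, mul_add]

end GraphDistance

/-- `A` and `B` are semi-separated: the diameter of `A` is at most `η` times the distance
between `A` and `B`. -/
def SemiSeparated {P : Type*} [PseudoMetricSpace P] (η : ℝ) (A B : Finset P) : Prop :=
  ∀ a ∈ A, ∀ a' ∈ A, ∀ p ∈ A, ∀ q ∈ B, dist a a' ≤ η * dist p q

/-- A semi-separated pair admits few bichromatic edges that join every bichromatic pair of
points `p ∈ A` and `q ∈ B`: either by three short edges, or by an edge from `q` to a point of `A`
whose color differs from that of `p`. -/
theorem SemiSeparated.exists_edges {P ι : Type*} [PseudoMetricSpace P] {η : ℝ}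
    {A B : Finset P} (hAB : SemiSeparated η A B) (col : P → ι) :
    ∃ E : Finset (Sym2 P), E.card ≤ A.card + B.card ∧
      (∀ e ∈ E, ∃ a ∈ A, ∃ b ∈ B, col a ≠ col b ∧ e = s(a, b)) ∧
      ∀ p ∈ A, ∀ q ∈ B, col p ≠ col q → ∃ a ∈ A, s(a, q) ∈ E ∧
        (col a = col p → ∃ b, s(a, b) ∈ E ∧ s(p, b) ∈ E ∧
          dist a b ≤ (1 + 2 * η) * dist p q ∧ dist p b ≤ (1 + 2 * η) * dist p q) := by
  classical
  have hα : ∀ q : P, ∃ a, (∃ a ∈ A, col a ≠ col q) → a ∈ A ∧ col a ≠ col q := fun q => by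
    by_cases h : ∃ a ∈ A, col a ≠ col q
    · exact ⟨h.choose, fun _ => h.choose_spec⟩
    · exact ⟨q, fun h' => absurd h' h⟩
  choose α hα using hα
  rcases A.eq_empty_or_nonempty with rfl | ⟨a₀, ha₀⟩
  · exact ⟨∅, by simp⟩
  have hβ : ∀ c : ι, ∃ b, (∃ b ∈ B, col b ≠ c) → b ∈ B ∧ col b ≠ c ∧
      ∀ b' ∈ B, col b' ≠ c → dist a₀ b ≤ dist a₀ b' := fun c => by
    by_cases h : ∃ b ∈ B, col b ≠ c
    · have hne : (B.filter (col · ≠ c)).Nonempty := by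
        obtain ⟨b, hb, hc⟩ := h
        exact ⟨b, Finset.mem_filter.2 ⟨hb, hc⟩⟩
      obtain ⟨b, hb, hmin⟩ := Finset.exists_min_image _ (dist a₀) hne
      rw [Finset.mem_filter] at hb
      exact ⟨b, fun _ => ⟨hb.1, hb.2, fun b' h1 h2 => hmin b' (Finset.mem_filter.2 ⟨h1, h2⟩)⟩⟩
    · exact ⟨a₀, fun h' => absurd h' h⟩
  choose β hβ using hβ
  set B' := B.filter fun q => ∃ a ∈ A, col a ≠ col q with hB'
  set A' := A.filter fun p => ∃ b ∈ B, col b ≠ col p with hA'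
  refine ⟨A'.image (fun p => s(p, β (col p))) ∪ B'.image (fun q => s(α q, q)), ?_, ?_, ?_⟩
  · refine (Finset.card_union_le _ _).trans (add_le_add ?_ ?_)
    · exact Finset.card_image_le.trans (Finset.card_filter_le _ _)
    · exact Finset.card_image_le.trans (Finset.card_filter_le _ _)
  · intro e he
    rcases Finset.mem_union.1 he with he | he
    · obtain ⟨p, hp, rfl⟩ := Finset.mem_image.1 he
      rw [hA', Finset.mem_filter] at hp
      have := hβ _ hp.2
      exact ⟨p, hp.1, _, this.1, this.2.1.symm, rfl⟩
    · obtain ⟨q, hq, rfl⟩ := Finset.mem_image.1 he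
      rw [hB', Finset.mem_filter] at hq
      have := hα _ hq.2
      exact ⟨_, this.1, q, hq.1, this.2, rfl⟩
  · intro p hp q hq hpq
    have hq' : ∃ a ∈ A, col a ≠ col q := ⟨p, hp, hpq⟩
    obtain ⟨haA, haq⟩ := hα q hq'
    refine ⟨α q, haA, Finset.mem_union_right _
      (Finset.mem_image_of_mem _ (Finset.mem_filter.2 ⟨hq, hq'⟩)), fun hc => ?_⟩
    have hp' : ∃ b ∈ B, col b ≠ col p := ⟨q, hq, hpq.symm⟩
    obtain ⟨hbB, hbp, hmin⟩ := hβ _ hp'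
    have hmem : ∀ a ∈ A, col a = col p → s(a, β (col p)) ∈
        A'.image (fun p => s(p, β (col p))) ∪ B'.image (fun q => s(α q, q)) := fun a ha hac => by
      refine Finset.mem_union_left _ (Finset.mem_image.2 ⟨a, ?_, by rw [hac]⟩)
      exact Finset.mem_filter.2 ⟨ha, by rwa [hac]⟩
    have hdist : ∀ a ∈ A, dist a (β (col p)) ≤ (1 + 2 * η) * dist p q := fun a ha => by
      have h1 := hmin q hq hpq.symm
      have h2 := hAB a ha a₀ ha₀ p hp q hq
      have h3 := hAB a₀ ha₀ p hp p hp q hq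
      have h4 := dist_triangle a a₀ (β (col p))
      have h5 := dist_triangle a₀ p q
      linarith
    exact ⟨_, hmem _ haA hc, hmem p hp rfl, hdist _ haA, hdist p hp⟩

/-- The family `L` of pairs of subsets of `S` is `η`-semi-separated and every pair of points
related by `R` lies, in some order, in one of the products `A × B` with `(A, B) ∈ L`. -/
structure IsSemiSeparatedCover {P : Type*} [PseudoMetricSpace P] (η : ℝ) (S : Finset P)
    (R : P → P → Prop) (L : List (Finset P × Finset P)) : Prop where
  fst_subset : ∀ X ∈ L, X.1 ⊆ S
  snd_subset : ∀ X ∈ L, X.2 ⊆ S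
  semiSeparated : ∀ X ∈ L, SemiSeparated η X.1 X.2
  cover : ∀ p q, R p q → ∃ X ∈ L, p ∈ X.1 ∧ q ∈ X.2 ∨ q ∈ X.1 ∧ p ∈ X.2

/-- The weight of a family of pairs of finite sets: the sum of the sizes of all sets. -/
def weight {P : Type*} (L : List (Finset P × Finset P)) : ℕ :=
  (L.map fun X => X.1.card + X.2.card).sum

/-- A semi-separated pair decomposition yields a bichromatic graph that spans all bichromatic
edges with stretch `3 + ε` and has at most as many edges as the decomposition has weight. -/
theorem exists_bichromatic_spanner {P ι : Type*} [MetricSpace P] {ε : ℝ} (hε0 : 0 < ε)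
    (hε1 : ε < 1) {S : Finset P} {L : List (Finset P × Finset P)}
    (hL : IsSemiSeparatedCover (ε / 5) S (fun p q => p ∈ S ∧ q ∈ S ∧ p ≠ q) L) (col : P → ι) :
    ∃ E : Finset (Sym2 P), E.card ≤ weight L ∧
      (∀ e ∈ E, ∃ a ∈ S, ∃ b ∈ S, col a ≠ col b ∧ e = s(a, b)) ∧
      ∀ p ∈ S, ∀ q ∈ S, col p ≠ col q →
        gdist (E : Set (Sym2 P)) p q ≤ ENNReal.ofReal (3 + ε) * edist p q := by
  classical
  have hE : ∀ X : Finset P × Finset P, ∃ E : Finset (Sym2 P), X ∈ L →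
      E.card ≤ X.1.card + X.2.card ∧
      (∀ e ∈ E, ∃ a ∈ X.1, ∃ b ∈ X.2, col a ≠ col b ∧ e = s(a, b)) ∧
      ∀ p ∈ X.1, ∀ q ∈ X.2, col p ≠ col q → ∃ a ∈ X.1, s(a, q) ∈ E ∧
        (col a = col p → ∃ b, s(a, b) ∈ E ∧ s(p, b) ∈ E ∧
          dist a b ≤ (1 + 2 * (ε / 5)) * dist p q ∧
          dist p b ≤ (1 + 2 * (ε / 5)) * dist p q) := fun X => by
    by_cases hX : X ∈ L
    · obtain ⟨E, h⟩ := (hL.semiSeparated X hX).exists_edges col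
      exact ⟨E, fun _ => h⟩
    · exact ⟨∅, fun h => absurd h hX⟩
  choose F hF using hE
  refine ⟨L.toFinset.biUnion F, ?_, ?_, ?_⟩
  · calc (L.toFinset.biUnion F).card ≤ ∑ X ∈ L.toFinset, (F X).card := Finset.card_biUnion_le
      _ ≤ ∑ X ∈ L.toFinset, (X.1.card + X.2.card) :=
        Finset.sum_le_sum fun X hX => (hF X (List.mem_toFinset.1 hX)).1
      _ ≤ ∑ X ∈ L.toFinset, L.count X • (X.1.card + X.2.card) := by
        refine Finset.sum_le_sum fun X hX => ?_
        have := List.count_pos_iff.2 (List.mem_toFinset.1 hX)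
        rw [smul_eq_mul]
        exact Nat.le_mul_of_pos_left _ this
      _ = weight L := by
        rw [weight, Finset.sum_list_map_count]
        congr!
  · intro e he
    obtain ⟨X, hX, heX⟩ := Finset.mem_biUnion.1 he
    rw [List.mem_toFinset] at hX
    obtain ⟨a, ha, b, hb, h⟩ := (hF X hX).2.1 e heX
    exact ⟨a, hL.fst_subset X hX ha, b, hL.snd_subset X hX hb, h⟩
  set E := L.toFinset.biUnion F with hE
  have hFE : ∀ X ∈ L, ∀ e ∈ F X, e ∈ (E : Set (Sym2 P)) := fun X hX e he =>
    Finset.mem_coe.2 (Finset.mem_biUnion.2 ⟨X, List.mem_toFinset.2 hX, he⟩)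
  have hofReal : ∀ {x : ℝ} {p q p' q' : P}, dist p q ≤ x * dist p' q' → 0 ≤ x →
      edist p q ≤ ENNReal.ofReal x * edist p' q' := fun {x p q p' q'} h hx => by
    rw [edist_dist, edist_dist, ← ENNReal.ofReal_mul hx]
    exact ENNReal.ofReal_le_ofReal h
  by_contra! hcon
  obtain ⟨p₀, hp₀, q₀, hq₀, hc₀, hlt₀⟩ := hcon
  obtain ⟨⟨p, q⟩, hpq, hmin⟩ := Finset.exists_min_image
    ((S ×ˢ S).filter fun x => col x.1 ≠ col x.2 ∧
      ENNReal.ofReal (3 + ε) * edist x.1 x.2 < gdist (E : Set (Sym2 P)) x.1 x.2)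
    (fun x => dist x.1 x.2) ⟨(p₀, q₀),
      Finset.mem_filter.2 ⟨Finset.mem_product.2 ⟨hp₀, hq₀⟩, hc₀, hlt₀⟩⟩
  simp only [Finset.mem_filter, Finset.mem_product] at hpq hmin
  obtain ⟨⟨hp, hq⟩, hc, hlt⟩ := hpq
  have key : ∀ p ∈ S, ∀ q ∈ S, col p ≠ col q →
      (∀ a ∈ S, col a ≠ col p → dist p a < dist p q →
        gdist (E : Set (Sym2 P)) p a ≤ ENNReal.ofReal (3 + ε) * edist p a) →
      ∀ X ∈ L, p ∈ X.1 → q ∈ X.2 →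
      gdist (E : Set (Sym2 P)) p q ≤ ENNReal.ofReal (3 + ε) * edist p q := by
    intro p hp q hq hc hmin X hX hpX hqX
    have hpos : 0 < dist p q := dist_pos.2 fun h => hc (by rw [h])
    obtain ⟨a, ha, haq, hb⟩ := (hF X hX).2.2 p hpX q hqX hc
    have hsep := hL.semiSeparated X hX p hpX a ha p hpX q hqX
    have hdaq : dist a q ≤ (1 + ε / 5) * dist p q := by
      have := dist_triangle_left a q p
      linarith
    have hgaq : gdist (E : Set (Sym2 P)) a q ≤ ENNReal.ofReal (1 + ε / 5) * edist p q :=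
      (gdist_le_edist (hFE X hX _ haq)).trans (hofReal hdaq (by positivity))
    by_cases hac : col a = col p
    · obtain ⟨b, hab, hpb, h1, h2⟩ := hb hac
      have hba : s(b, a) ∈ (E : Set (Sym2 P)) := by
        rw [Sym2.eq_swap]
        exact hFE X hX _ hab
      calc gdist (E : Set (Sym2 P)) p q ≤ edist p b + (edist b a + gdist E a q) :=
            (gdist_le_edist_add (hFE X hX _ hpb)).trans
              (add_le_add le_rfl (gdist_le_edist_add hba))
        _ ≤ ENNReal.ofReal (1 + 2 * (ε / 5)) * edist p q +
            (ENNReal.ofReal (1 + 2 * (ε / 5)) * edist p q +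
              ENNReal.ofReal (1 + ε / 5) * edist p q) := by
            refine add_le_add (hofReal h2 (by positivity))
              (add_le_add (hofReal ?_ (by positivity)) hgaq)
            rwa [dist_comm]
        _ = ENNReal.ofReal (3 + ε) * edist p q := by
            rw [← add_mul, ← add_mul, ← ENNReal.ofReal_add (by positivity) (by positivity),
              ← ENNReal.ofReal_add (by positivity) (by positivity)]
            ring_nf
    · have hlt : dist p a < dist p q := by nlinarith
      calc gdist (E : Set (Sym2 P)) p q ≤ gdist E p a + gdist E a q := gdist_triangle _ _ _ _
        _ ≤ ENNReal.ofReal (3 + ε) * (ENNReal.ofReal (ε / 5) * edist p q) +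
            ENNReal.ofReal (1 + ε / 5) * edist p q := by
            refine add_le_add ((hmin a (hL.fst_subset X hX ha) hac hlt).trans ?_) hgaq
            gcongr
            exact hofReal hsep (by positivity)
        _ = ENNReal.ofReal ((3 + ε) * (ε / 5) + (1 + ε / 5)) * edist p q := by
            rw [← mul_assoc, ← add_mul, ← ENNReal.ofReal_mul (by positivity),
              ← ENNReal.ofReal_add (by positivity) (by positivity)]
        _ ≤ ENNReal.ofReal (3 + ε) * edist p q := by
            refine mul_le_mul' (ENNReal.ofReal_le_ofReal ?_) le_rfl
            nlinarith
  have hgcomm : ∀ p q : P, gdist (E : Set (Sym2 P)) p q ≤ gdist (E : Set (Sym2 P)) q p :=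
    gdist_le_gdist_symm _
  obtain ⟨X, hX, hpqX⟩ := hL.cover p q ⟨hp, hq, fun h => hc (by rw [h])⟩
  rcases hpqX with ⟨h1, h2⟩ | ⟨h1, h2⟩
  · refine hlt.not_ge (key p hp q hq hc (fun a ha hac hd => ?_) X hX h1 h2)
    by_contra! h
    exact hd.not_ge (hmin (p, a) ⟨⟨hp, ha⟩, hac.symm, h⟩)
  · refine hlt.not_ge ((hgcomm p q).trans ?_)
    rw [edist_comm]
    refine key q hq p hp hc.symm (fun a ha hac hd => ?_) X hX h1 h2
    by_contra! h
    rw [dist_comm q p] at hd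
    exact hd.not_ge (hmin (q, a) ⟨⟨hq, ha⟩, hac.symm, h⟩)

theorem weight_append {P : Type*} (L L' : List (Finset P × Finset P)) :
    weight (L ++ L') = weight L + weight L' := by
  simp [weight]

theorem weight_cons {P : Type*} (X : Finset P × Finset P) (L : List (Finset P × Finset P)) :
    weight (X :: L) = X.1.card + X.2.card + weight L := by
  simp [weight]

section SemiSeparatedCover

variable {P : Type*} [PseudoMetricSpace P] {η : ℝ} {S T : Finset P} {R R' : P → P → Prop}
  {L L' : List (Finset P × Finset P)}

theorem IsSemiSeparatedCover.mono (h : IsSemiSeparatedCover η S R L) (hST : S ⊆ T)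
    (hR : ∀ p q, R' p q → R p q) : IsSemiSeparatedCover η T R' L where
  fst_subset X hX := (h.fst_subset X hX).trans hST
  snd_subset X hX := (h.snd_subset X hX).trans hST
  semiSeparated := h.semiSeparated
  cover p q hpq := h.cover p q (hR p q hpq)

theorem IsSemiSeparatedCover.append (h : IsSemiSeparatedCover η S R L)
    (h' : IsSemiSeparatedCover η S R' L') :
    IsSemiSeparatedCover η S (fun p q => R p q ∨ R' p q) (L ++ L') where
  fst_subset X hX := (List.mem_append.1 hX).elim (h.fst_subset X) (h'.fst_subset X)
  snd_subset X hX := (List.mem_append.1 hX).elim (h.snd_subset X) (h'.snd_subset X)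
  semiSeparated X hX := (List.mem_append.1 hX).elim (h.semiSeparated X) (h'.semiSeparated X)
  cover p q hpq := by
    rcases hpq with hpq | hpq
    · obtain ⟨X, hX, hpqX⟩ := h.cover p q hpq
      exact ⟨X, List.mem_append_left _ hX, hpqX⟩
    · obtain ⟨X, hX, hpqX⟩ := h'.cover p q hpq
      exact ⟨X, List.mem_append_right _ hX, hpqX⟩

theorem SemiSeparated.isSemiSeparatedCover {A B : Finset P} (h : SemiSeparated η A B) (hA : A ⊆ S)
    (hB : B ⊆ S) : IsSemiSeparatedCover η S (fun p q => p ∈ A ∧ q ∈ B) [(A, B)] where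
  fst_subset X hX := by rwa [List.mem_singleton.1 hX]
  snd_subset X hX := by rwa [List.mem_singleton.1 hX]
  semiSeparated X hX := by rwa [List.mem_singleton.1 hX]
  cover p q hpq := ⟨_, List.mem_singleton_self _, Or.inl hpq⟩

theorem isSemiSeparatedCover_nil (hR : ∀ p q, ¬ R p q) : IsSemiSeparatedCover η S R [] where
  fst_subset X hX := by simp at hX
  snd_subset X hX := by simp at hX
  semiSeparated X hX := by simp at hX
  cover p q hpq := absurd hpq (hR p q)

/-- The decomposition into all pairs of singletons. -/
theorem exists_singleton_cover (hη : 0 ≤ η) (S : Finset P) :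
    ∃ L, IsSemiSeparatedCover η S (fun p q => p ∈ S ∧ q ∈ S) L ∧
      weight L = 2 * (S.card * S.card) := by
  refine ⟨(S ×ˢ S).toList.map fun x => ({x.1}, {x.2}), ⟨?_, ?_, ?_, ?_⟩, ?_⟩
  · intro X hX
    obtain ⟨x, hx, rfl⟩ := List.mem_map.1 hX
    exact Finset.singleton_subset_iff.2 (Finset.mem_product.1 (Finset.mem_toList.1 hx)).1
  · intro X hX
    obtain ⟨x, hx, rfl⟩ := List.mem_map.1 hX
    exact Finset.singleton_subset_iff.2 (Finset.mem_product.1 (Finset.mem_toList.1 hx)).2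
  · intro X hX
    obtain ⟨x, hx, rfl⟩ := List.mem_map.1 hX
    intro a ha a' ha' p _ q _
    rw [Finset.mem_singleton.1 ha, Finset.mem_singleton.1 ha', dist_self]
    positivity
  · intro p q hpq
    exact ⟨({p}, {q}), by simpa using hpq, by simp⟩
  · simp [weight, Function.comp_def, mul_comm]

end SemiSeparatedCover

/-- At every scale `ρ`, the space can be partitioned into cells (the fibers of a map to `κ`) of
diameter at most `η * ρ`, such that every ball of radius `ρ` meets at most `N` cells. -/
def HasGrids (P κ : Type*) [PseudoMetricSpace P] [DecidableEq κ] (η : ℝ) (N : ℕ) : Prop :=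
  ∀ ρ : ℝ, 0 < ρ → ∃ key : P → κ, (∀ p q, key p = key q → dist p q ≤ η * ρ) ∧
    ∀ (q : P) (T : Finset P), (∀ p ∈ T, dist p q ≤ ρ) → (T.image key).card ≤ N

theorem EuclideanSpace.hasGrids {d : ℕ} (hd : 1 ≤ d) {η : ℝ} (hη : 0 < η) :
    HasGrids (EuclideanSpace ℝ (Fin d)) (Fin d → ℤ) η ((2 * (⌈d / η⌉₊ + 1) + 1) ^ d) := by
  intro ρ hρ
  have hd' : (1 : ℝ) ≤ d := by exact_mod_cast hd
  set h : ℝ := η * ρ / d with hh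
  have hpos : 0 < h := by positivity
  have hdh : d * h = η * ρ := by rw [hh]; field_simp
  set M := ⌈(d : ℝ) / η⌉₊ with hM
  refine ⟨fun p k => ⌊p k / h⌋, fun p q hpq => ?_, fun q T hT => ?_⟩
  · rw [EuclideanSpace.dist_eq]
    refine Real.sqrt_le_iff.2 ⟨by positivity, ?_⟩
    calc ∑ i, dist (p i) (q i) ^ 2 ≤ ∑ _i : Fin d, h ^ 2 := by
          refine Finset.sum_le_sum fun i _ => ?_
          have h1 := Int.abs_sub_lt_one_of_floor_eq_floor (congrFun hpq i)
          rw [← sub_div, abs_div, abs_of_pos hpos, div_lt_one hpos] at h1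
          rw [Real.dist_eq]
          gcongr
      _ = d * h ^ 2 := by simp
      _ ≤ (d * h) ^ 2 := by nlinarith [sq_nonneg h, mul_nonneg (sub_nonneg.2 hd') (sq_nonneg h)]
      _ = (η * ρ) ^ 2 := by rw [hdh]
  · have hsub : T.image (fun p k => ⌊p k / h⌋) ⊆
        Fintype.piFinset fun k => Finset.Icc (⌊q k / h⌋ - (M + 1 : ℤ)) (⌊q k / h⌋ + (M + 1 : ℤ)) := by
      intro z hz
      obtain ⟨p, hp, rfl⟩ := Finset.mem_image.1 hz
      refine Fintype.mem_piFinset.2 fun k => ?_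
      have h1 : |p k - q k| ≤ ρ := by
        refine le_trans ?_ (hT p hp)
        rw [dist_eq_norm]
        simpa using PiLp.norm_apply_le (p - q) k
      have h2 : |p k / h - q k / h| ≤ M := by
        rw [← sub_div, abs_div, abs_of_pos hpos, div_le_iff₀ hpos]
        refine h1.trans ?_
        have : d / η ≤ M := Nat.le_ceil _
        calc ρ = d / η * h := by rw [hh]; field_simp
          _ ≤ M * h := by gcongr
      rw [abs_le] at h2
      have h3 := Int.floor_le (p k / h)
      have h4 := Int.lt_floor_add_one (p k / h)
      have h5 := Int.floor_le (q k / h)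
      have h6 := Int.lt_floor_add_one (q k / h)
      rw [Finset.mem_Icc]
      constructor
      · have : (⌊q k / h⌋ : ℝ) - (M + 1) < ⌊p k / h⌋ := by linarith
        exact_mod_cast this.le
      · have : (⌊p k / h⌋ : ℝ) < ⌊q k / h⌋ + (M + 1) := by linarith
        exact_mod_cast this.le
    refine (Finset.card_le_card hsub).trans (le_of_eq ?_)
    have : ∀ z : ℤ, (Finset.Icc (z - (M + 1 : ℤ)) (z + (M + 1 : ℤ))).card = 2 * (M + 1) + 1 := by
      intro z
      rw [Int.card_Icc]
      omega
    simp only [Fintype.card_piFinset, this]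
    simp

section Grids

variable {P κ : Type*} [MetricSpace P] [DecidableEq κ]

/-- A ball containing a constant fraction of the points, whose concentric double contains at most
half of them. -/
theorem HasGrids.exists_ball {N : ℕ} (hN : HasGrids P κ (1 / 4) N) (hN0 : 0 < N) {S : Finset P}
    (hS : 2 * N < S.card) :
    ∃ c : P, ∃ r : ℝ, 0 < r ∧ S.card ≤ 2 * N * (S.filter fun p => dist p c ≤ r).card ∧
      ∀ T ⊆ S, (∀ p ∈ T, dist p c ≤ 2 * r) → 2 * T.card ≤ S.card := by
  classical
  have hfar : ∀ T ⊆ S, T.Nonempty → ∀ p, ∃ e ∈ T, ∀ q ∈ T, dist q p ≤ dist e p :=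
    fun T _ hT p => Finset.exists_max_image T (fun q => dist q p) hT
  have hSne : S.Nonempty := Finset.card_pos.1 (by omega)
  obtain ⟨p₀, hp₀⟩ := hSne
  obtain ⟨e₀, he₀, hmax₀⟩ := hfar S subset_rfl ⟨p₀, hp₀⟩ p₀
  have hne : ((S ×ˢ S).filter fun x : P × P =>
      S.card ≤ 2 * N * (S.filter fun p => dist p x.1 ≤ dist x.2 x.1).card).Nonempty := by
    refine ⟨(p₀, e₀), Finset.mem_filter.2 ⟨Finset.mem_product.2 ⟨hp₀, he₀⟩, ?_⟩⟩
    rw [Finset.filter_true_of_mem hmax₀]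
    exact Nat.le_mul_of_pos_left _ (by omega)
  obtain ⟨⟨c, e⟩, hce, hmin⟩ := Finset.exists_min_image _ (fun x => dist x.2 x.1) hne
  simp only [Finset.mem_filter, Finset.mem_product] at hce hmin
  obtain ⟨⟨hc, he⟩, hcard⟩ := hce
  have hr : 0 < dist e c := by
    refine dist_pos.2 fun h => ?_
    subst h
    have : (S.filter fun p => dist p e ≤ dist e e) ⊆ {e} := fun p hp => by
      rw [dist_self, Finset.mem_filter] at hp
      exact Finset.mem_singleton.2 (dist_le_zero.1 hp.2)
    have := Finset.card_le_card this
    rw [Finset.card_singleton] at this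
    have := Nat.mul_le_mul_left (2 * N) this
    omega
  refine ⟨c, dist e c, hr, hcard, fun T hTS hT => ?_⟩
  obtain ⟨key, hkey, hcount⟩ := hN (2 * dist e c) (by positivity)
  have hsmall : ∀ z ∈ T.image key, 2 * N * (T.filter fun p => key p = z).card ≤ S.card := by
    intro z hz
    obtain ⟨p, hp, rfl⟩ := Finset.mem_image.1 hz
    set F := T.filter fun q => key q = key p with hF
    have hFT : F ⊆ T := Finset.filter_subset _ _
    obtain ⟨f, hf, hfmax⟩ := hfar F (hFT.trans hTS) ⟨p, Finset.mem_filter.2 ⟨hp, rfl⟩⟩ p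
    by_contra! hlt
    have h1 := hmin (p, f) ⟨⟨hTS hp, hTS (hFT hf)⟩, hlt.le.trans <| Nat.mul_le_mul_left _ <|
      Finset.card_le_card fun q hq => Finset.mem_filter.2 ⟨hTS (hFT hq), hfmax q hq⟩⟩
    have h2 := hkey f p (Finset.mem_filter.1 hf).2
    simp only at h1
    linarith
  have h1 : 2 * N * T.card ≤ N * S.card := by
    calc 2 * N * T.card = ∑ z ∈ T.image key, 2 * N * (T.filter fun p => key p = z).card := by
          rw [← Finset.mul_sum, Finset.card_eq_sum_card_image key T]
      _ ≤ (T.image key).card * S.card := by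
          simpa using Finset.sum_le_card_nsmul _ _ _ hsmall
      _ ≤ N * S.card := Nat.mul_le_mul_right _ (hcount c T hT)
  exact Nat.le_of_mul_le_mul_left (by linarith) hN0

/-- Pairs at distance about `ρ` are covered by semi-separated pairs of linear total weight. -/
theorem HasGrids.exists_scale_cover {η : ℝ} (hη0 : 0 < η) (hη1 : η ≤ 1) {N : ℕ}
    (hN : HasGrids P κ (η / 4) N) {ρ : ℝ} (hρ : 0 < ρ) {S A B : Finset P} (hA : A ⊆ S)
    (hB : B ⊆ S) :
    ∃ L, IsSemiSeparatedCover η S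
        (fun p q => p ∈ A ∧ q ∈ B ∧ ρ / 2 ≤ dist p q ∧ dist p q ≤ ρ) L ∧
      weight L ≤ (N + 1) * S.card := by
  classical
  obtain ⟨key, hkey, hcount⟩ := hN ρ hρ
  let cell : κ → Finset P := fun z => A.filter fun p => key p = z
  let near : κ → Finset P := fun z =>
    B.filter fun q => ∃ p ∈ cell z, ρ / 2 ≤ dist p q ∧ dist p q ≤ ρ
  refine ⟨(A.image key).toList.map fun z => (cell z, near z), ⟨?_, ?_, ?_, ?_⟩, ?_⟩
  · intro X hX
    obtain ⟨z, -, rfl⟩ := List.mem_map.1 hX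
    exact (Finset.filter_subset _ _).trans hA
  · intro X hX
    obtain ⟨z, -, rfl⟩ := List.mem_map.1 hX
    exact (Finset.filter_subset _ _).trans hB
  · intro X hX
    obtain ⟨z, -, rfl⟩ := List.mem_map.1 hX
    intro a ha a' ha' p hp q hq
    obtain ⟨-, p', hp', hle, -⟩ := Finset.mem_filter.1 hq
    have hcell : ∀ a ∈ cell z, ∀ a' ∈ cell z, dist a a' ≤ η / 4 * ρ := fun a ha a' ha' =>
      hkey a a' ((Finset.mem_filter.1 ha).2.trans (Finset.mem_filter.1 ha').2.symm)
    have h1 := hcell a ha a' ha'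
    have h2 := hcell p' hp' p hp
    have h3 := dist_triangle p' p q
    have h4 : ρ / 4 ≤ dist p q := by nlinarith
    nlinarith
  · rintro p q ⟨hp, hq, h1, h2⟩
    have hpc : p ∈ cell (key p) := Finset.mem_filter.2 ⟨hp, rfl⟩
    exact ⟨(cell (key p), near (key p)),
      List.mem_map.2 ⟨key p, Finset.mem_toList.2 (Finset.mem_image_of_mem _ hp), rfl⟩,
      Or.inl ⟨hpc, Finset.mem_filter.2 ⟨hq, p, hpc, h1, h2⟩⟩⟩
  · have h1 : ∑ z ∈ A.image key, (cell z).card = A.card :=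
      (Finset.card_eq_sum_card_image key A).symm
    have h2 : ∑ z ∈ A.image key, (near z).card ≤ B.card * N := by
      have hswap := Finset.sum_card_bipartiteAbove_eq_sum_card_bipartiteBelow
        (s := A.image key) (t := B)
        (fun z q => ∃ p ∈ cell z, ρ / 2 ≤ dist p q ∧ dist p q ≤ ρ)
      refine (le_of_eq hswap).trans ?_
      rw [← smul_eq_mul]
      refine Finset.sum_le_card_nsmul _ _ _ fun q hq => ?_
      refine (Finset.card_le_card ?_).trans
        (hcount q (A.filter fun p => dist p q ≤ ρ) fun p hp => (Finset.mem_filter.1 hp).2)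
      intro z hz
      obtain ⟨-, p, hp, -, hpq⟩ := (Finset.mem_bipartiteBelow _).1 hz
      obtain ⟨hpA, rfl⟩ := Finset.mem_filter.1 hp
      exact Finset.mem_image_of_mem _ (Finset.mem_filter.2 ⟨hpA, hpq⟩)
    have h3 : weight ((A.image key).toList.map fun z => (cell z, near z)) =
        ∑ z ∈ A.image key, ((cell z).card + (near z).card) := by
      simp [weight, Function.comp_def, Finset.sum_map_toList]
    rw [h3, Finset.sum_add_distrib, h1]
    have h4 := Finset.card_le_card hA
    have h5 := Finset.card_le_card hB
    nlinarith [Nat.mul_le_mul_right N h5]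

end Grids

/-- By averaging, some radius `x ∈ [r, 2r]` is rarely close to the values of `f`. -/
theorem exists_radius {P : Type*} (f : P → ℝ) (S : Finset P) (I : ℕ) {r R : ℝ} (hr : 0 < r)
    (hR : 0 ≤ R) :
    ∃ x ∈ Set.Icc r (2 * r),
      ∑ i ∈ Finset.range I, ((S.filter fun p => |f p - x| ≤ R * r / 2 ^ i).card : ℝ) ≤
        4 * R * S.card := by
  classical
  let u : ℕ → P → ℝ → ℝ := fun i p =>
    (Metric.closedBall (f p) (R * r / 2 ^ i)).indicator fun _ => 1
  let g : ℝ → ℝ := fun x => ∑ i ∈ Finset.range I, ∑ p ∈ S, u i p x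
  have hu : ∀ i p, MeasureTheory.Integrable (u i p) := fun i p =>
    (MeasureTheory.integrable_indicator_iff measurableSet_closedBall).2
      (MeasureTheory.integrableOn_const MeasureTheory.measure_closedBall_lt_top.ne)
  have hui : ∀ i p, ∫ x, u i p x = 2 * (R * r / 2 ^ i) := fun i p => by
    rw [MeasureTheory.integral_indicator measurableSet_closedBall]
    simp only [MeasureTheory.integral_const, smul_eq_mul, mul_one,
      MeasureTheory.measureReal_restrict_apply_univ]
    exact Real.volume_real_closedBall (by positivity)
  have hg : MeasureTheory.Integrable g :=
    MeasureTheory.integrable_finsetSum _ fun i _ =>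
      MeasureTheory.integrable_finsetSum _ fun p _ => hu i p
  have hgi : ∫ x, g x ≤ 4 * R * S.card * r := by
    have hgeom : ∑ i ∈ Finset.range I, ((1 : ℝ) / 2) ^ i ≤ 2 := sum_geometric_two_le I
    calc ∫ x, g x = ∑ i ∈ Finset.range I, ∑ p ∈ S, 2 * (R * r / 2 ^ i) := by
          rw [MeasureTheory.integral_finsetSum _ fun i _ =>
            MeasureTheory.integrable_finsetSum _ fun p _ => hu i p]
          refine Finset.sum_congr rfl fun i _ => ?_
          rw [MeasureTheory.integral_finsetSum _ fun p _ => hu i p]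
          exact Finset.sum_congr rfl fun p _ => hui i p
      _ = 2 * R * S.card * r * ∑ i ∈ Finset.range I, ((1 : ℝ) / 2) ^ i := by
          rw [Finset.mul_sum]
          refine Finset.sum_congr rfl fun i _ => ?_
          rw [Finset.sum_const, nsmul_eq_mul, one_div, inv_pow]
          ring
      _ ≤ 2 * R * S.card * r * 2 := by gcongr
      _ = 4 * R * S.card * r := by ring
  have hvol : MeasureTheory.volume.real (Set.Icc r (2 * r)) = r := by
    rw [Real.volume_real_Icc_of_le (by linarith)]
    ring
  obtain ⟨x, hx, hle⟩ := MeasureTheory.exists_le_setAverage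
    (μ := MeasureTheory.volume) (s := Set.Icc r (2 * r)) (f := g)
    (by rw [Real.volume_Icc]; simpa using by linarith) (by simp) hg.integrableOn
  refine ⟨x, hx, ?_⟩
  have hgx : g x =
      ∑ i ∈ Finset.range I, ((S.filter fun p => |f p - x| ≤ R * r / 2 ^ i).card : ℝ) := by
    refine Finset.sum_congr rfl fun i _ => ?_
    rw [Finset.card_filter, Nat.cast_sum]
    refine Finset.sum_congr rfl fun p _ => ?_
    simp [u, Set.indicator_apply, Real.dist_eq, abs_sub_comm]
  rw [← hgx]
  refine hle.trans ?_
  rw [MeasureTheory.setAverage_eq, hvol, smul_eq_mul, inv_mul_le_iff₀ hr, mul_comm r]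
  refine le_trans (MeasureTheory.setIntegral_le_integral hg ?_) hgi
  refine Filter.Eventually.of_forall fun x => ?_
  exact Finset.sum_nonneg fun i _ => Finset.sum_nonneg fun p _ =>
    Set.indicator_nonneg (fun _ _ => zero_le_one) _

section Decomposition

variable {P κ κ' : Type*} [MetricSpace P] [DecidableEq κ] [DecidableEq κ']

/-- Pairs separated by a sphere about `c`, covered scale by scale; a point is only used at the
scales exceeding its distance to the sphere. -/
theorem HasGrids.exists_sphere_cover {η : ℝ} (hη0 : 0 < η) (hη1 : η ≤ 1) {N : ℕ}
    (hN : HasGrids P κ (η / 4) N) {ρ : ℝ} (hρ : 0 < ρ) (S : Finset P) (c : P) (x : ℝ) (I : ℕ) :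
    ∃ L, IsSemiSeparatedCover η S
        (fun p q => p ∈ S ∧ q ∈ S ∧ dist p c ≤ x ∧ x < dist q c ∧
          ρ / 2 ^ I < dist p q ∧ dist p q ≤ ρ) L ∧
      weight L ≤ (N + 1) * ∑ i ∈ Finset.range I,
        (S.filter fun p => |dist p c - x| ≤ ρ / 2 ^ i).card := by
  classical
  induction I with
  | zero =>
    refine ⟨[], isSemiSeparatedCover_nil ?_, by simp [weight]⟩
    rintro p q ⟨-, -, -, -, h1, h2⟩
    rw [pow_zero, div_one] at h1
    exact h1.not_ge h2
  | succ I ih =>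
    obtain ⟨L, hL, hw⟩ := ih
    set T := S.filter fun p => |dist p c - x| ≤ ρ / 2 ^ I with hT
    have hTS : T ⊆ S := Finset.filter_subset _ _
    obtain ⟨L', hL', hw'⟩ := hN.exists_scale_cover hη0 hη1 (ρ := ρ / 2 ^ I) (by positivity)
      (Finset.filter_subset (fun p => dist p c ≤ x) T)
      (Finset.filter_subset (fun p => x < dist p c) T)
    refine ⟨L' ++ L, ((hL'.mono hTS fun p q h => h).append hL).mono subset_rfl ?_, ?_⟩
    · rintro p q ⟨hp, hq, hpx, hqx, h1, h2⟩
      by_cases h : ρ / 2 ^ I < dist p q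
      · exact Or.inr ⟨hp, hq, hpx, hqx, h, h2⟩
      · rw [not_lt] at h
        have h3 := dist_triangle_left q c p
        have hpT : p ∈ T := Finset.mem_filter.2 ⟨hp, by rw [abs_le]; constructor <;> linarith⟩
        have hqT : q ∈ T := Finset.mem_filter.2 ⟨hq, by rw [abs_le]; constructor <;> linarith⟩
        refine Or.inl ⟨Finset.mem_filter.2 ⟨hpT, hpx⟩, Finset.mem_filter.2 ⟨hqT, hqx⟩, ?_, h⟩
        rw [pow_succ, ← div_div] at h1
        exact h1.le
    · rw [weight_append, Finset.sum_range_succ, mul_add]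
      linarith

/-- A balanced split of a large point set such that the pairs of points separated by it admit a
semi-separated cover of linear weight. -/
theorem exists_balanced_split {M N : ℕ} {η : ℝ} (hη0 : 0 < η) (hη1 : η ≤ 1)
    (hM : HasGrids P κ' (1 / 4) M) (hM0 : 0 < M) (hN : HasGrids P κ (η / 4) N) {S : Finset P}
    (hS : 2 * M < S.card) :
    ∃ A B : Finset P, A ⊆ S ∧ B ⊆ S ∧ (∀ p ∈ S, p ∈ A ∨ p ∈ B) ∧ A.card + B.card = S.card ∧
      2 * A.card ≤ S.card ∧ S.card ≤ 2 * M * A.card ∧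
      ∃ L, IsSemiSeparatedCover η S (fun p q => p ∈ A ∧ q ∈ B) L ∧
        (weight L : ℝ) ≤ (1 + (N + 1) * (4 * (4 + 4 / η))) * S.card := by
  classical
  obtain ⟨c, r, hr, hin, hout⟩ := hM.exists_ball hM0 hS
  set R : ℝ := 4 + 4 / η with hR
  have hRη : η * (R - 4) = 4 := by rw [hR]; field_simp; ring
  have hR0 : 0 < R := by positivity
  have hI : ∃ I : ℕ, ∀ p ∈ S, ∀ q ∈ S, p ≠ q → R * r / 2 ^ I < dist p q := by
    have hev : ∀ᶠ I : ℕ in Filter.atTop, ∀ x ∈ S ×ˢ S, x.1 ≠ x.2 →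
        R * r / 2 ^ I < dist x.1 x.2 := by
      rw [Filter.eventually_all_finset]
      intro x _
      by_cases hx : x.1 = x.2
      · simp [hx]
      have htend : Filter.Tendsto (fun I : ℕ => R * r / 2 ^ I) Filter.atTop (nhds 0) :=
        tendsto_const_nhds.div_atTop (tendsto_pow_atTop_atTop_of_one_lt one_lt_two)
      filter_upwards [htend.eventually_lt_const (dist_pos.2 hx)] with I hI _ using hI
    obtain ⟨I, hI⟩ := hev.exists
    exact ⟨I, fun p hp q hq => hI (p, q) (Finset.mem_product.2 ⟨hp, hq⟩)⟩
  obtain ⟨I, hI⟩ := hI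
  obtain ⟨x, ⟨hx1, hx2⟩, hx⟩ := exists_radius (fun p => dist p c) S I hr hR0.le
  obtain ⟨L, hL, hw⟩ := hN.exists_sphere_cover hη0 hη1 (mul_pos hR0 hr) S c x I
  set A := S.filter fun p => dist p c ≤ x with hA
  set B := S.filter fun p => ¬ dist p c ≤ x with hB
  have hAS : A ⊆ S := Finset.filter_subset _ _
  have hBS : B ⊆ S := Finset.filter_subset _ _
  have hAB : A.card + B.card = S.card := Finset.card_filter_add_card_filter_not _
  have hAx : ∀ p ∈ A, dist p c ≤ 2 * r := fun p hp => (Finset.mem_filter.1 hp).2.trans hx2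
  set F := B.filter fun q => (R - 2) * r ≤ dist q c with hF
  have hFB : F ⊆ B := Finset.filter_subset _ _
  have hsep : SemiSeparated η A F := by
    intro a ha a' ha' p hp q hq
    have h1 := hAx a ha
    have h2 := hAx a' ha'
    have h3 := hAx p hp
    have h4 := (Finset.mem_filter.1 hq).2
    have h5 := dist_triangle_right a a' c
    have h6 := dist_triangle_left q c p
    have h7 : (R - 4) * r ≤ dist p q := by linarith
    have h8 : η * ((R - 4) * r) ≤ η * dist p q := by gcongr
    rw [← mul_assoc, hRη] at h8
    linarith
  refine ⟨A, B, hAS, hBS, fun p hp => ?_, hAB, hout A hAS hAx, hin.trans ?_, (A, F) :: L, ?_, ?_⟩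
  · by_cases h : dist p c ≤ x
    · exact Or.inl (Finset.mem_filter.2 ⟨hp, h⟩)
    · exact Or.inr (Finset.mem_filter.2 ⟨hp, h⟩)
  · refine Nat.mul_le_mul_left _ (Finset.card_le_card ?_)
    exact Finset.monotone_filter_right _ fun p _ hp => hp.trans hx1
  · refine ((hsep.isSemiSeparatedCover hAS (hFB.trans hBS)).append hL).mono subset_rfl ?_
    rintro p q ⟨hp, hq⟩
    by_cases hqF : q ∈ F
    · exact Or.inl ⟨hp, hqF⟩
    have h1 := Finset.mem_filter.1 hp
    have h2 := Finset.mem_filter.1 hq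
    have h3 : dist q c < (R - 2) * r := by
      by_contra! h
      exact hqF (Finset.mem_filter.2 ⟨hq, h⟩)
    have h4 := dist_triangle_right p q c
    have h5 := hAx p hp
    refine Or.inr ⟨h1.1, h2.1, h1.2, not_le.1 h2.2, hI p h1.1 q h2.1 ?_, by linarith⟩
    rintro rfl
    exact h2.2 h1.2
  · have h1 : (A.card + F.card : ℝ) ≤ S.card := by
      exact_mod_cast hAB ▸ Nat.add_le_add_left (Finset.card_le_card hFB) _
    have h2 : (weight L : ℝ) ≤ (N + 1) * (4 * R * S.card) := by
      calc (weight L : ℝ) ≤ (N + 1) * ∑ i ∈ Finset.range I,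
            ((S.filter fun p => |dist p c - x| ≤ R * r / 2 ^ i).card : ℝ) := by exact_mod_cast hw
        _ ≤ (N + 1) * (4 * R * S.card) := by gcongr
    rw [weight_cons]
    push_cast
    linarith

/-- Every finite set of `n` points has a semi-separated pair decomposition of weight
`O(n log n)`. -/
theorem exists_semiSeparatedCover {M N : ℕ} {η : ℝ} (hη0 : 0 < η) (hη1 : η ≤ 1)
    (hM : HasGrids P κ' (1 / 4) M) (hM0 : 0 < M) (hN : HasGrids P κ (η / 4) N) :
    ∃ C : ℝ, ∀ S : Finset P, ∃ L,
      IsSemiSeparatedCover η S (fun p q => p ∈ S ∧ q ∈ S ∧ p ≠ q) L ∧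
        (weight L : ℝ) ≤ C * S.card * Real.logb 2 S.card := by
  set D : ℝ := 1 + (N + 1) * (4 * (4 + 4 / η)) with hD
  have hD0 : 0 < D := by positivity
  have hM1 : (1 : ℝ) ≤ M := by exact_mod_cast hM0
  set θ : ℝ := 1 - 1 / (2 * M) with hθ
  have hM2 : (1 : ℝ) / (2 * M) ≤ 1 / 2 := by gcongr; linarith
  have hθ0 : 0 < θ := by linarith
  have hθ2 : 1 / 2 ≤ θ := by linarith
  have hθ1 : θ < 1 := by
    have : (0 : ℝ) < 1 / (2 * M) := by positivity
    linarith
  set γ : ℝ := -Real.logb 2 θ with hγ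
  have hγ0 : 0 < γ := neg_pos.2 (Real.logb_neg one_lt_two hθ0 hθ1)
  set C : ℝ := 4 * M + D / γ with hC
  have hC0 : 0 ≤ C := by positivity
  refine ⟨C, fun S => ?_⟩
  induction hn : S.card using Nat.strong_induction_on generalizing S with
  | _ n ih =>
  subst hn
  rcases le_or_gt S.card 1 with h1 | h1
  · refine ⟨[], isSemiSeparatedCover_nil ?_, ?_⟩
    · rintro p q ⟨hp, hq, hpq⟩
      exact hpq (Finset.card_le_one.1 h1 p hp q hq)
    · interval_cases S.card <;> simp [weight]
  have hlog : 1 ≤ Real.logb 2 S.card := by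
    rw [Real.le_logb_iff_rpow_le one_lt_two (by positivity), Real.rpow_one]
    exact_mod_cast h1
  rcases le_or_gt S.card (2 * M) with h2 | h2
  · obtain ⟨L, hL, hw⟩ := exists_singleton_cover hη0.le S
    refine ⟨L, hL.mono subset_rfl fun p q h => ⟨h.1, h.2.1⟩, ?_⟩
    have h3 : (S.card : ℝ) ≤ 2 * M := by exact_mod_cast h2
    rw [hw]
    push_cast
    calc 2 * ((S.card : ℝ) * S.card) ≤ 2 * (2 * M * S.card) := by gcongr
      _ = (4 * M + 0) * S.card * 1 := by ring
      _ ≤ C * S.card * Real.logb 2 S.card := by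
        rw [hC]
        gcongr
        positivity
  obtain ⟨A, B, hA, hB, hSAB, hcard, hA2, hAM, L, hL, hw⟩ :=
    exists_balanced_split hη0 hη1 hM hM0 hN h2
  have hApos : 0 < A.card := by
    by_contra! h
    rw [Nat.le_zero.1 h] at hAM
    omega
  obtain ⟨LA, hLA, hwA⟩ := ih A.card (by omega) A rfl
  obtain ⟨LB, hLB, hwB⟩ := ih B.card (by omega) B rfl
  have hcard' : (A.card : ℝ) + B.card = S.card := by exact_mod_cast hcard
  have hAθ : (A.card : ℝ) ≤ θ * S.card := by
    have : (2 : ℝ) * A.card ≤ S.card := by exact_mod_cast hA2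
    nlinarith
  have hBθ : (B.card : ℝ) ≤ θ * S.card := by
    have h3 : (S.card : ℝ) ≤ 2 * M * A.card := by exact_mod_cast hAM
    have h4 : 1 / (2 * M) * (S.card : ℝ) ≤ A.card := by
      rw [one_div, inv_mul_le_iff₀ (by positivity)]
      exact h3
    rw [hθ]
    linarith
  have hpart : ∀ T : Finset P, (T.card : ℝ) ≤ θ * S.card →
      C * T.card * Real.logb 2 T.card ≤ C * T.card * (Real.logb 2 S.card - γ) := by
    intro T hT
    rcases Nat.eq_zero_or_pos T.card with h0 | h0
    · simp [h0]
    have h0' : (0 : ℝ) < T.card := by exact_mod_cast h0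
    have hS0 : (S.card : ℝ) ≠ 0 := by positivity
    refine mul_le_mul_of_nonneg_left ?_ (by positivity)
    calc Real.logb 2 T.card ≤ Real.logb 2 (θ * S.card) :=
          Real.logb_le_logb_of_le one_lt_two h0' hT
      _ = Real.logb 2 S.card - γ := by
          rw [Real.logb_mul hθ0.ne' hS0, hγ]
          ring
  have hcov := hL.append
    ((hLA.mono hA fun p q h => h).append (hLB.mono hB fun p q h => h))
  refine ⟨L ++ (LA ++ LB), ⟨hcov.fst_subset, hcov.snd_subset, hcov.semiSeparated, ?_⟩, ?_⟩
  · rintro p q ⟨hp, hq, hpq⟩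
    rcases hSAB p hp with hpA | hpB <;> rcases hSAB q hq with hqA | hqB
    · exact hcov.cover p q (Or.inr (Or.inl ⟨hpA, hqA, hpq⟩))
    · exact hcov.cover p q (Or.inl ⟨hpA, hqB⟩)
    · obtain ⟨X, hX, h⟩ := hcov.cover q p (Or.inl ⟨hqA, hpB⟩)
      exact ⟨X, hX, h.symm⟩
    · exact hcov.cover p q (Or.inr (Or.inr ⟨hpB, hqB, hpq⟩))
  · have hDC : D ≤ C * γ := by
      rw [hC, add_mul, div_mul_cancel₀ _ hγ0.ne']
      have : 0 ≤ 4 * M * γ := by positivity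
      linarith
    rw [weight_append, weight_append]
    push_cast
    calc (weight L : ℝ) + (weight LA + weight LB)
        ≤ C * γ * S.card + (C * A.card * (Real.logb 2 S.card - γ) +
            C * B.card * (Real.logb 2 S.card - γ)) :=
          add_le_add (hw.trans (by gcongr))
            (add_le_add (hwA.trans (hpart A hAθ)) (hwB.trans (hpart B hBθ)))
      _ = C * S.card * Real.logb 2 S.card := by
          rw [← hcard']
          ring

end Decomposition

/-- For every dimension `d ≥ 1` and every `0 < ε < 1` there is a constant `C`
such that for every `k ≥ 2`, every finite set `S` of `n ≥ 2` points in `ℝ^d`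
and every partition of `S` into `k` subsets, the complete `k`-partite geometric
graph on `S` has a `(3+ε)`-spanner with at most `C·n·log₂ n` edges. -/
theorem three_plus_eps_spanner (d : ℕ) (hd : 1 ≤ d) (ε : ℝ) (hε0 : 0 < ε) (hε1 : ε < 1) :
    ∃ C : ℝ, ∀ k : ℕ, 2 ≤ k →
      ∀ (S : Finset (EuclideanSpace ℝ (Fin d)))
        (Cl : Fin k → Set (EuclideanSpace ℝ (Fin d))),
        2 ≤ S.card →
        (∀ i j, i ≠ j → Disjoint (Cl i) (Cl j)) →
        (⋃ i, Cl i) = ↑S →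
        ∃ E : Finset (Sym2 (EuclideanSpace ℝ (Fin d))),
          (↑E : Set (Sym2 (EuclideanSpace ℝ (Fin d)))) ⊆ kpartiteEdges Cl ∧
          (E.card : ℝ) ≤ C * S.card * Real.logb 2 S.card ∧
          ∀ p ∈ S, ∀ q ∈ S,
            gdist (↑E : Set (Sym2 (EuclideanSpace ℝ (Fin d)))) p q ≤
              ENNReal.ofReal (3 + ε) * gdist (kpartiteEdges Cl) p q := by
  classical
  have hM0 : 0 < (2 * (⌈(d : ℝ) / (1 / 4)⌉₊ + 1) + 1) ^ d := by positivity
  obtain ⟨C, hC⟩ := exists_semiSeparatedCover (η := ε / 5) (by positivity) (by linarith)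
    (EuclideanSpace.hasGrids hd (by norm_num)) hM0 (EuclideanSpace.hasGrids hd (by positivity))
  refine ⟨C, fun k hk S Cl _ hdisj hunion => ?_⟩
  have hcol : ∀ p, ∃ i : Fin k, p ∈ S → p ∈ Cl i := fun p => by
    by_cases hp : p ∈ S
    · rw [← Finset.mem_coe, ← hunion, Set.mem_iUnion] at hp
      exact hp.imp fun i hi _ => hi
    · exact ⟨⟨0, by omega⟩, fun h => absurd h hp⟩
  choose col hcol using hcol
  have hmem : ∀ i, ∀ p ∈ Cl i, p ∈ S ∧ col p = i := fun i p hp => by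
    have hpS : p ∈ S := by
      rw [← Finset.mem_coe, ← hunion]
      exact Set.mem_iUnion_of_mem i hp
    refine ⟨hpS, ?_⟩
    by_contra h
    exact Set.disjoint_left.1 (hdisj _ _ h) (hcol p hpS) hp
  obtain ⟨L, hL, hw⟩ := hC S
  obtain ⟨E, hcard, hE, hspan⟩ := exists_bichromatic_spanner hε0 hε1 hL col
  refine ⟨E, fun e he => ?_, le_trans (by exact_mod_cast hcard) hw, fun p _ q _ => ?_⟩
  · obtain ⟨a, ha, b, hb, hab, rfl⟩ := hE e he
    exact ⟨a, b, rfl, col a, col b, hab, hcol a ha, hcol b hb⟩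
  have hspan' : ∀ a b i j, i ≠ j → a ∈ Cl i → b ∈ Cl j →
      gdist (E : Set (Sym2 (EuclideanSpace ℝ (Fin d)))) a b ≤
        ENNReal.ofReal (3 + ε) * edist a b := fun a b i j hij ha hb => by
    obtain ⟨haS, rfl⟩ := hmem i a ha
    obtain ⟨hbS, rfl⟩ := hmem j b hb
    exact hspan a haS b hbS hij
  refine gdist_le_mul_gdist (ENNReal.ofReal_pos.2 (by linarith)).ne' ENNReal.ofReal_ne_top ?_ p q
  rintro a b ⟨a', b', hab, i, j, hij, ha, hb⟩
  rcases Sym2.eq_iff.1 hab with ⟨rfl, rfl⟩ | ⟨rfl, rfl⟩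
  · exact hspan' _ _ i j hij ha hb
  · exact hspan' _ _ j i hij.symm hb ha
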